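/- If 𝒟 is a strongly first order family of generalized dependencies, then every sentence of FO(⊔, 𝒟) (first-order logic with team semantics augmented with global disjunction and the atoms of 𝒟) is equivalent to some first-order sentence. If 𝒟 is moreover relativizable, then every sentence of FO(⊔, 𝒟^(P)) is equivalent to some first-order sentence. -/

import Mathlib

namespace DSFO

/-- A purely relational signature: for each arity, a type of relation symbols. -/
abbrev Signature := ℕ → Type

/-- The empty signature. -/
def Sig0 : Signature := fun _ => Empty

/-- The signature with a single `k`-ary relation symbol `R`. -/
def SigR (k : ℕ) : Signature := fun n => PLift (n = k)

/-- Syntax of team-semantics formulas (in negation normal form, with the two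
additional connectives: global disjunction `gdisj` and contradictory negation
`cneg`) over a relational signature `S`, with generalized dependency atoms
indexed by `ι` with arities `ar`.  Variables are natural numbers. -/
inductive TS (S : Signature) (ι : Type) (ar : ι → ℕ) : Type
  | rel {k : ℕ} (r : S k) (v : Fin k → ℕ)
  | nrel {k : ℕ} (r : S k) (v : Fin k → ℕ)
  | eq (x y : ℕ)
  | neq (x y : ℕ)
  | dep (i : ι) (v : Fin (ar i) → ℕ)
  | and (φ ψ : TS S ι ar)
  | or (φ ψ : TS S ι ar)
  | gdisj (φ ψ : TS S ι ar)
  | cneg (φ : TS S ι ar)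
  | ex (v : ℕ) (φ : TS S ι ar)
  | al (v : ℕ) (φ : TS S ι ar)

/-- The always-true literal `⊤`. -/
def TS.top {S : Signature} {ι : Type} {ar : ι → ℕ} : TS S ι ar := .eq 0 0

/-- The arity function for "no dependency atoms". -/
def noAtoms : Empty → ℕ := fun e => e.elim

/-- First-order formulas over `S` (no dependency atoms; here `cneg` plays the
role of ordinary classical negation and `gdisj` of ordinary disjunction, so
this is full first-order logic). -/
abbrev FOF (S : Signature) := TS S Empty noAtoms

/-- First-order formulas over the empty signature. -/
abbrev EF := FOF Sig0

/-- Free variables of a formula. -/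
def fv {S : Signature} {ι : Type} {ar : ι → ℕ} : TS S ι ar → Set ℕ
  | .rel _ v => Set.range v
  | .nrel _ v => Set.range v
  | .eq x y => {x, y}
  | .neq x y => {x, y}
  | .dep _ v => Set.range v
  | .and φ ψ => fv φ ∪ fv ψ
  | .or φ ψ => fv φ ∪ fv ψ
  | .gdisj φ ψ => fv φ ∪ fv ψ
  | .cneg φ => fv φ
  | .ex v φ => fv φ \ {v}
  | .al v φ => fv φ \ {v}

/-- A sentence is a formula with no free variables. -/
def IsSentence {S : Signature} {ι : Type} {ar : ι → ℕ} (φ : TS S ι ar) : Prop :=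
  fv φ = ∅

/-- No global disjunctions occur. -/
def NoGdisj {S : Signature} {ι : Type} {ar : ι → ℕ} : TS S ι ar → Prop
  | .rel _ _ => True
  | .nrel _ _ => True
  | .eq _ _ => True
  | .neq _ _ => True
  | .dep _ _ => True
  | .and φ ψ => NoGdisj φ ∧ NoGdisj ψ
  | .or φ ψ => NoGdisj φ ∧ NoGdisj ψ
  | .gdisj _ _ => False
  | .cneg φ => NoGdisj φ
  | .ex _ φ => NoGdisj φ
  | .al _ φ => NoGdisj φ

/-- No contradictory negations occur. -/
def NoCneg {S : Signature} {ι : Type} {ar : ι → ℕ} : TS S ι ar → Prop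
  | .rel _ _ => True
  | .nrel _ _ => True
  | .eq _ _ => True
  | .neq _ _ => True
  | .dep _ _ => True
  | .and φ ψ => NoCneg φ ∧ NoCneg ψ
  | .or φ ψ => NoCneg φ ∧ NoCneg ψ
  | .gdisj φ ψ => NoCneg φ ∧ NoCneg ψ
  | .cneg _ => False
  | .ex _ φ => NoCneg φ
  | .al _ φ => NoCneg φ

/-- Formulas of `FO(𝒟)` proper: no `gdisj` and no `cneg`. -/
def Plain {S : Signature} {ι : Type} {ar : ι → ℕ} (φ : TS S ι ar) : Prop :=
  NoCneg φ ∧ NoGdisj φ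

/-- Atomic formulas: first-order literals and dependency atoms. -/
def Atomic {S : Signature} {ι : Type} {ar : ι → ℕ} : TS S ι ar → Prop
  | .rel _ _ => True
  | .nrel _ _ => True
  | .eq _ _ => True
  | .neq _ _ => True
  | .dep _ _ => True
  | _ => False

/-- Formulas of `FO(∼₀, 𝒟)`: the contradictory negation may appear only in
front of first-order literals and dependency atoms (and there is no `gdisj`). -/
def Cneg0 {S : Signature} {ι : Type} {ar : ι → ℕ} : TS S ι ar → Prop
  | .rel _ _ => True
  | .nrel _ _ => True
  | .eq _ _ => True
  | .neq _ _ => True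
  | .dep _ _ => True
  | .and φ ψ => Cneg0 φ ∧ Cneg0 ψ
  | .or φ ψ => Cneg0 φ ∧ Cneg0 ψ
  | .gdisj _ _ => False
  | .cneg φ => Atomic φ
  | .ex _ φ => Cneg0 φ
  | .al _ φ => Cneg0 φ

/-- The negation normal form of the (dual) negation of a formula. -/
def TS.nneg {S : Signature} {ι : Type} {ar : ι → ℕ} : TS S ι ar → TS S ι ar
  | .rel r v => .nrel r v
  | .nrel r v => .rel r v
  | .eq x y => .neq x y
  | .neq x y => .eq x y
  | .dep i v => .cneg (.dep i v)
  | .and φ ψ => .or (TS.nneg φ) (TS.nneg ψ)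
  | .or φ ψ => .and (TS.nneg φ) (TS.nneg ψ)
  | .gdisj φ ψ => .and (TS.nneg φ) (TS.nneg ψ)
  | .cneg φ => φ
  | .ex v φ => .al v (TS.nneg φ)
  | .al v φ => .ex v (TS.nneg φ)

/-- Iterated existential quantification over a list of variables. -/
def exs {S : Signature} {ι : Type} {ar : ι → ℕ} (l : List ℕ) (φ : TS S ι ar) :
    TS S ι ar := l.foldr TS.ex φ

/-- An interpretation of a relational signature in a domain `M`. -/
abbrev Interp (S : Signature) (M : Type) := ∀ k, S k → Set (Fin k → M)

/-- The unique interpretation of the empty signature. -/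
def eI (M : Type) : Interp Sig0 M := fun _ e => e.elim

/-- The interpretation of `SigR k` given by a `k`-ary relation `R`. -/
def interpR {k : ℕ} {M : Type} (R : Set (Fin k → M)) : Interp (SigR k) M :=
  fun _ r => {s | (fun i => s (Fin.cast r.down.symm i)) ∈ R}

/-- Tarskian (single-assignment) satisfaction.  Dependency atoms are
(vacuously) interpreted as true; this is only used on first-order formulas. -/
def FSat {S : Signature} {ι : Type} {ar : ι → ℕ} (M : Type) (I : Interp S M) :
    (ℕ → M) → TS S ι ar → Prop
  | s, .rel r v => (fun i => s (v i)) ∈ I _ r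
  | s, .nrel r v => (fun i => s (v i)) ∉ I _ r
  | s, .eq x y => s x = s y
  | s, .neq x y => s x ≠ s y
  | _, .dep _ _ => True
  | s, .and φ ψ => FSat M I s φ ∧ FSat M I s ψ
  | s, .or φ ψ => FSat M I s φ ∨ FSat M I s ψ
  | s, .gdisj φ ψ => FSat M I s φ ∨ FSat M I s ψ
  | s, .cneg φ => ¬ FSat M I s φ
  | s, .ex v φ => ∃ m : M, FSat M I (Function.update s v m) φ
  | s, .al v φ => ∀ m : M, FSat M I (Function.update s v m) φ

/-- Truth of a first-order sentence (Tarskian semantics). -/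
def FOTrue {S : Signature} {ι : Type} {ar : ι → ℕ} (M : Type) (I : Interp S M)
    (φ : TS S ι ar) : Prop :=
  ∀ s : ℕ → M, FSat M I s φ

/-- The relation `X(x̄)` determined by a team `X` and a tuple of variables `x̄`. -/
def teamProj {M : Type} {k : ℕ} (v : Fin k → ℕ) (X : Set (ℕ → M)) :
    Set (Fin k → M) := {t | ∃ s ∈ X, t = fun j => s (v j)}

/-- (Lax) team semantics.  `A` gives the semantics of each dependency atom as a
function of the relation `X(x̄)`. -/
def TSat {S : Signature} {ι : Type} {ar : ι → ℕ} (M : Type) (I : Interp S M)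
    (A : ∀ i, Set (Fin (ar i) → M) → Prop) :
    TS S ι ar → Set (ℕ → M) → Prop
  | .rel r v, X => ∀ s ∈ X, (fun i => s (v i)) ∈ I _ r
  | .nrel r v, X => ∀ s ∈ X, (fun i => s (v i)) ∉ I _ r
  | .eq x y, X => ∀ s ∈ X, s x = s y
  | .neq x y, X => ∀ s ∈ X, s x ≠ s y
  | .dep i v, X => A i (teamProj v X)
  | .and φ ψ, X => TSat M I A φ X ∧ TSat M I A ψ X
  | .or φ ψ, X => ∃ Y Z : Set (ℕ → M), Y ∪ Z = X ∧ TSat M I A φ Y ∧ TSat M I A ψ Z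
  | .gdisj φ ψ, X => TSat M I A φ X ∨ TSat M I A ψ X
  | .cneg φ, X => ¬ TSat M I A φ X
  | .ex v φ, X => ∃ H : (ℕ → M) → Set M, (∀ s ∈ X, (H s).Nonempty) ∧
      TSat M I A φ {s' | ∃ s ∈ X, ∃ m ∈ H s, s' = Function.update s v m}
  | .al v φ, X => TSat M I A φ {s' | ∃ s ∈ X, ∃ m : M, s' = Function.update s v m}

/-- Truth of a sentence under team semantics: satisfaction by the team of all
assignments (by locality, equivalent to satisfaction by `{∅}`). -/
def TTrue {S : Signature} {ι : Type} {ar : ι → ℕ} (M : Type) (I : Interp S M)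
    (A : ∀ i, Set (Fin (ar i) → M) → Prop) (φ : TS S ι ar) : Prop :=
  TSat M I A φ Set.univ

/-- A `k`-ary dependency predicate: a class of pairs `(M, R)`. -/
abbrev DepPred (k : ℕ) := ∀ M : Type, Set (Fin k → M) → Prop

/-- Closure under isomorphisms (part of the definition of a generalized
dependency). -/
def IsoClosed {k : ℕ} (D : DepPred k) : Prop :=
  ∀ (M N : Type) (e : M ≃ N) (R : Set (Fin k → M)),
    D M R → D N ((fun f => e ∘ f) '' R)

/-- The complement `∼D` of a dependency. -/
def complD {k : ℕ} (D : DepPred k) : DepPred k := fun M R => ¬ D M R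

def DownwardsClosed {k : ℕ} (D : DepPred k) : Prop :=
  ∀ (M : Type) (R R' : Set (Fin k → M)), D M R → R' ⊆ R → D M R'

/-- The downwards closure `D↓`. -/
def dClosure {k : ℕ} (D : DepPred k) : DepPred k :=
  fun M R => ∃ R', R ⊆ R' ∧ D M R'

/-- `D_max`: the maximal models of `D`. -/
def DMax {k : ℕ} (D : DepPred k) : DepPred k :=
  fun M R => D M R ∧ ∀ R', R ⊂ R' → ¬ D M R'

/-- The empty team property. -/
def EmptyTeamProp {k : ℕ} (D : DepPred k) : Prop :=
  ∀ M : Type, Nontrivial M → D M (∅ : Set (Fin k → M))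

/-- `D` is a first-order dependency: it is the class of models of a first-order
sentence over the signature `{R}`. -/
def FirstOrderDep {k : ℕ} (D : DepPred k) : Prop :=
  ∃ ψ : FOF (SigR k), IsSentence ψ ∧
    ∀ (M : Type), Nontrivial M → ∀ R : Set (Fin k → M),
      (D M R ↔ FOTrue M (interpR R) ψ)

/-- The interpretation of a unary predicate symbol as a subset of the domain. -/
def PSet {S : Signature} {M : Type} (I : Interp S M) (P : S 1) : Set M :=
  {m | (fun _ => m) ∈ I 1 P}

/-- Semantics of the relativization `D^(P)` of `D` to the unary predicate `P`:
`𝔐 ⊨_X D^(P) x̄` iff `(P^𝔐, X(x̄)) ∈ D`. -/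
def relSem {k : ℕ} (D : DepPred k) {S : Signature} (P : S 1)
    (M : Type) (I : Interp S M) (R : Set (Fin k → M)) : Prop :=
  (∀ f ∈ R, ∀ j, f j ∈ PSet I P) ∧
    D (↥(PSet I P)) {g : Fin k → ↥(PSet I P) | (fun j => (g j : M)) ∈ R}

/-- A family `𝒟` of generalized dependencies is strongly first order: every
sentence of `FO(𝒟)` is equivalent to some first-order sentence. -/
def SFOFam {ι : Type} {ar : ι → ℕ} (D : ∀ i, DepPred (ar i)) : Prop :=
  ∀ (S : Signature) (φ : TS S ι ar), IsSentence φ → Plain φ →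
    ∃ ψ : FOF S, IsSentence ψ ∧
      ∀ (M : Type), Nontrivial M → ∀ I : Interp S M,
        (TTrue M I (fun i => D i M) φ ↔ FOTrue M I ψ)

/-- A single dependency is strongly first order iff `{D}` is. -/
def SFOd {k : ℕ} (D : DepPred k) : Prop :=
  SFOFam (ι := Unit) (ar := fun _ => k) (fun _ => D)

/-- A family `𝒟` is relativizable: every sentence of `FO(𝒟^(P))` is equivalent
to some sentence of `FO(𝒟)`. -/
def RelativizableFam {ι : Type} {ar : ι → ℕ} (D : ∀ i, DepPred (ar i)) : Prop :=
  ∀ (S : Signature) (P : S 1) (φ : TS S ι ar), IsSentence φ → Plain φ →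
    ∃ ψ : TS S ι ar, IsSentence ψ ∧ Plain ψ ∧
      ∀ (M : Type), Nontrivial M → ∀ I : Interp S M,
        (TTrue M I (fun i => relSem (D i) P M I) φ ↔ TTrue M I (fun i => D i M) ψ)

def Relativizable1 {k : ℕ} (D : DepPred k) : Prop :=
  RelativizableFam (ι := Unit) (ar := fun _ => k) (fun _ => D)

/-- The family `𝒟 ∪ ∼𝒟`. -/
def withComplFam {ι : Type} {ar : ι → ℕ} (D : ∀ i, DepPred (ar i)) :
    ∀ i : ι ⊕ ι, DepPred (Sum.elim ar ar i) :=
  fun i => match i with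
    | .inl a => D a
    | .inr a => complD (D a)

/-- `D` is doubly strongly first order: `{D, ∼D}` is strongly first order. -/
def DSFOd {k : ℕ} (D : DepPred k) : Prop :=
  SFOFam (ι := Bool) (ar := fun _ => k)
    (fun b => match b with | true => D | false => complD D)

/-- The constancy atom of arity `k`. -/
def constD (k : ℕ) : DepPred k := fun _ R => ∀ f ∈ R, ∀ g ∈ R, f = g

/-- The totality atom of arity `k`. -/
def allD (k : ℕ) : DepPred k := fun M R => R = (Set.univ : Set (Fin k → M))

/-- The family `𝒟 ∪ {const}` (constancy atoms of every arity). -/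
def withConst {ι : Type} {ar : ι → ℕ} (D : ∀ i, DepPred (ar i)) :
    ∀ i : ι ⊕ ℕ, DepPred (Sum.elim ar id i) :=
  fun i => match i with
    | .inl a => D a
    | .inr n => constD n

/-- The atoms of `𝒟^(P) ∪ {const}`. -/
def withConstRel {ι : Type} {ar : ι → ℕ} (D : ∀ i, DepPred (ar i))
    {S : Signature} (P : S 1) (M : Type) (I : Interp S M) :
    ∀ i : ι ⊕ ℕ, Set (Fin (Sum.elim ar id i) → M) → Prop :=
  fun i => match i with
    | .inl a => relSem (D a) P M I
    | .inr n => constD n M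

/-- Atom indices of the logic `FO(𝒟₀, ⊔, const, All)`: the 0-ary first-order
dependencies `[ψ]`, the constancy atoms and the totality atoms. -/
inductive CIdx : Type
  | d0 (ψ : EF) (hψ : IsSentence ψ)
  | const (k : ℕ)
  | total (k : ℕ)

def cAr : CIdx → ℕ
  | .d0 _ _ => 0
  | .const k => k
  | .total k => k

def cSem (M : Type) : ∀ i : CIdx, Set (Fin (cAr i) → M) → Prop
  | .d0 ψ _, _ => FOTrue M (eI M) ψ
  | .const _, R => ∀ f ∈ R, ∀ g ∈ R, f = g
  | .total _, R => R = Set.univ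

/-- Embedding of first-order formulas over the empty signature into any
team logic. -/
def embedEF {S : Signature} {ι : Type} {ar : ι → ℕ} : EF → TS S ι ar
  | .rel r _ => Empty.elim r
  | .nrel r _ => Empty.elim r
  | .eq x y => .eq x y
  | .neq x y => .neq x y
  | .dep i _ => Empty.elim i
  | .and φ ψ => .and (embedEF φ) (embedEF ψ)
  | .or φ ψ => .or (embedEF φ) (embedEF ψ)
  | .gdisj φ ψ => .gdisj (embedEF φ) (embedEF ψ)
  | .cneg φ => .cneg (embedEF φ)
  | .ex v φ => .ex v (embedEF φ)
  | .al v φ => .al v (embedEF φ)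

/-- Override the values of the variables `0, …, k-1` by the tuple `f`. -/
def overrideFin {M : Type} (k : ℕ) (f : Fin k → M) (s : ℕ → M) : ℕ → M :=
  fun v => if h : v < k then f ⟨v, h⟩ else s v

/-- `(M, R) ⊨ ∃ȳ ∀x̄ (R x̄ → θ(x̄, ȳ))`, where `x̄` is the tuple of variables
`0, …, k-1` and the remaining free variables `ȳ` of `θ` are witnessed by `s`. -/
def ExAllSem {k : ℕ} (M : Type) (R : Set (Fin k → M)) (θ : EF) : Prop :=
  ∃ s : ℕ → M, ∀ f ∈ R, FSat M (eI M) (overrideFin k f s) θ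

/-- `(M, R) ⊨ ∃ȳ ∀x̄ (R x̄ ↔ θ(x̄, ȳ))`. -/
def ExAllIffSem {k : ℕ} (M : Type) (R : Set (Fin k → M)) (θ : EF) : Prop :=
  ∃ s : ℕ → M, ∀ f : Fin k → M, (f ∈ R ↔ FSat M (eI M) (overrideFin k f s) θ)

/-- The assignment sending `x̄ = (0, …, k-1)` to `f`, `ȳ = (k, …, k+n-1)` to
`a`, and every other variable to its value under `s0`. -/
def tupAsg {M : Type} (k n : ℕ) (f : Fin k → M) (a : Fin n → M) (s0 : ℕ → M) :
    ℕ → M :=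
  fun v => if h : v < k then f ⟨v, h⟩ else if h2 : v - k < n then a ⟨v - k, h2⟩ else s0 v

/-- `R` is defined by the formula `θ(x̄, ȳ)` (with `x̄ = (0, …, k-1)` and
`ȳ = (k, …, k+n-1)`): there is a tuple `ā` of parameters such that
`R = {m̄ : 𝔐 ⊨ θ(m̄, ā)}`. -/
def DefinedBy {S : Signature} {M : Type} (I : Interp S M) (k n : ℕ)
    (θ : FOF S) (R : Set (Fin k → M)) : Prop :=
  ∃ a : Fin n → M, ∀ s0 : ℕ → M, R = {f | FSat M I (tupAsg k n f a s0) θ}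

/-- `θ(x̄, ȳ)` fixes the identity type of `ȳ = (k, …, k+n-1)`. -/
def FixesIdType {S : Signature} (k n : ℕ) (θ : FOF S) : Prop :=
  ∀ i j : Fin n,
    (∀ (M : Type), Nontrivial M → ∀ (I : Interp S M) (s : ℕ → M),
        FSat M I s θ → s (k + (i : ℕ)) = s (k + (j : ℕ))) ∨
    (∀ (M : Type), Nontrivial M → ∀ (I : Interp S M) (s : ℕ → M),
        FSat M I s θ → s (k + (i : ℕ)) ≠ s (k + (j : ℕ)))

/-- `(M, R := Xv) ⊨ ∃ȳ ∀x̄ (R x̄ → θ(x̄, ȳ))` where the `x̄`-slots of `θ` are the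
variables `v̄` and the `ȳ`-slots are the variables `ȳ`. -/
def projExAll {M : Type} {k n : ℕ} (v : Fin k → ℕ) (y : Fin n → ℕ) (θ : EF)
    (Xv : Set (Fin k → M)) : Prop :=
  ∃ b : Fin n → M, ∀ f ∈ Xv, ∀ s : ℕ → M,
    (∀ j, s (v j) = f j) → (∀ i, s (y i) = b i) → FSat M (eI M) s θ

/-- The `gdisj`-free disjuncts of a `cneg`-free formula, obtained by pulling all global
disjunctions to the front. -/
def gdisjuncts {S : Signature} {ι : Type} {ar : ι → ℕ} : TS S ι ar → List (TS S ι ar)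
  | .rel r v => [.rel r v]
  | .nrel r v => [.nrel r v]
  | .eq x y => [.eq x y]
  | .neq x y => [.neq x y]
  | .dep i v => [.dep i v]
  | .and φ ψ => (gdisjuncts φ).flatMap fun a => (gdisjuncts ψ).map fun b => .and a b
  | .or φ ψ => (gdisjuncts φ).flatMap fun a => (gdisjuncts ψ).map fun b => .or a b
  | .gdisj φ ψ => gdisjuncts φ ++ gdisjuncts ψ
  | .cneg _ => []
  | .ex v φ => (gdisjuncts φ).map (.ex v)
  | .al v φ => (gdisjuncts φ).map (.al v)

theorem plain_and_fv_subset_of_mem_gdisjuncts {S : Signature} {ι : Type} {ar : ι → ℕ}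
    (φ : TS S ι ar) : ∀ χ ∈ gdisjuncts φ, Plain χ ∧ fv χ ⊆ fv φ := by
  induction φ with
  | rel | nrel | eq | neq | dep => simp [gdisjuncts, Plain, NoCneg, NoGdisj]
  | and φ ψ ih₁ ih₂ | or φ ψ ih₁ ih₂ =>
    intro χ hχ
    simp only [gdisjuncts, List.mem_flatMap, List.mem_map] at hχ
    obtain ⟨a, ha, b, hb, rfl⟩ := hχ
    obtain ⟨⟨ha₁, ha₂⟩, ha₃⟩ := ih₁ a ha
    obtain ⟨⟨hb₁, hb₂⟩, hb₃⟩ := ih₂ b hb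
    exact ⟨⟨⟨ha₁, hb₁⟩, ⟨ha₂, hb₂⟩⟩, Set.union_subset_union ha₃ hb₃⟩
  | gdisj φ ψ ih₁ ih₂ =>
    intro χ hχ
    rcases List.mem_append.mp hχ with h | h
    · exact ⟨(ih₁ χ h).1, (ih₁ χ h).2.trans Set.subset_union_left⟩
    · exact ⟨(ih₂ χ h).1, (ih₂ χ h).2.trans Set.subset_union_right⟩
  | cneg => simp [gdisjuncts]
  | ex v φ ih | al v φ ih =>
    intro χ hχ
    obtain ⟨a, ha, rfl⟩ := List.mem_map.mp hχ
    exact ⟨(ih a ha).1, Set.sdiff_subset_sdiff_left (ih a ha).2⟩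

theorem tSat_iff_exists_mem_gdisjuncts {S : Signature} {ι : Type} {ar : ι → ℕ} (M : Type)
    (I : Interp S M) (A : ∀ i, Set (Fin (ar i) → M) → Prop) (φ : TS S ι ar) (hφ : NoCneg φ)
    (X : Set (ℕ → M)) : TSat M I A φ X ↔ ∃ χ ∈ gdisjuncts φ, TSat M I A χ X := by
  induction φ generalizing X with
  | rel | nrel | eq | neq | dep => simp [gdisjuncts]
  | and φ ψ ih₁ ih₂ =>
    simp only [TSat, gdisjuncts, ih₁ hφ.1, ih₂ hφ.2, List.mem_flatMap, List.mem_map]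
    constructor
    · rintro ⟨⟨a, ha, ha'⟩, b, hb, hb'⟩
      exact ⟨_, ⟨a, ha, b, hb, rfl⟩, ha', hb'⟩
    · rintro ⟨_, ⟨a, ha, b, hb, rfl⟩, ha', hb'⟩
      exact ⟨⟨a, ha, ha'⟩, b, hb, hb'⟩
  | or φ ψ ih₁ ih₂ =>
    simp only [TSat, gdisjuncts, ih₁ hφ.1, ih₂ hφ.2, List.mem_flatMap, List.mem_map]
    constructor
    · rintro ⟨Y, Z, hYZ, ⟨a, ha, ha'⟩, b, hb, hb'⟩
      exact ⟨_, ⟨a, ha, b, hb, rfl⟩, Y, Z, hYZ, ha', hb'⟩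
    · rintro ⟨_, ⟨a, ha, b, hb, rfl⟩, Y, Z, hYZ, ha', hb'⟩
      exact ⟨Y, Z, hYZ, ⟨a, ha, ha'⟩, b, hb, hb'⟩
  | gdisj φ ψ ih₁ ih₂ =>
    simp only [TSat, gdisjuncts, ih₁ hφ.1, ih₂ hφ.2, List.mem_append, or_and_right, exists_or]
  | cneg => exact hφ.elim
  | ex v φ ih =>
    simp only [TSat, gdisjuncts, ih hφ, List.mem_map]
    constructor
    · rintro ⟨H, hH, a, ha, ha'⟩
      exact ⟨_, ⟨a, ha, rfl⟩, H, hH, ha'⟩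
    · rintro ⟨_, ⟨a, ha, rfl⟩, H, hH, ha'⟩
      exact ⟨H, hH, a, ha, ha'⟩
  | al v φ ih =>
    simp only [TSat, gdisjuncts, ih hφ, List.mem_map]
    constructor
    · rintro ⟨a, ha, ha'⟩
      exact ⟨_, ⟨a, ha, rfl⟩, ha'⟩
    · rintro ⟨_, ⟨a, ha, rfl⟩, ha'⟩
      exact ⟨a, ha, ha'⟩

theorem fSat_congr {S : Signature} {ι : Type} {ar : ι → ℕ} (M : Type) (I : Interp S M)
    (φ : TS S ι ar) (s t : ℕ → M) (h : ∀ x ∈ fv φ, s x = t x) :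
    FSat M I s φ ↔ FSat M I t φ := by
  have update_agree {v : ℕ} {V : Set ℕ} {s t : ℕ → M} (h : ∀ x ∈ V \ {v}, s x = t x) (m : M) :
      ∀ x ∈ V, Function.update s v m x = Function.update t v m x := by
    intro x hx
    rcases eq_or_ne x v with rfl | hxv
    · simp
    · simpa [hxv] using h x ⟨hx, hxv⟩
  induction φ generalizing s t with
  | rel r v | nrel r v =>
    have : (fun i => s (v i)) = fun i => t (v i) := funext fun i => h _ ⟨i, rfl⟩
    simp only [FSat, this]
  | eq x y | neq x y => simp only [FSat, h x (by simp [fv]), h y (by simp [fv])]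
  | dep => rfl
  | and φ ψ ih₁ ih₂ | or φ ψ ih₁ ih₂ | gdisj φ ψ ih₁ ih₂ =>
    simp only [FSat, ih₁ s t fun x hx => h x (.inl hx), ih₂ s t fun x hx => h x (.inr hx)]
  | cneg φ ih => exact not_congr (ih s t h)
  | ex v φ ih => exact exists_congr fun m => ih _ _ (update_agree h m)
  | al v φ ih => exact forall_congr' fun m => ih _ _ (update_agree h m)

theorem foTrue_or_iff {S : Signature} {ι : Type} {ar : ι → ℕ} (M : Type) [Nonempty M]
    (I : Interp S M) {φ ψ : TS S ι ar} (hφ : IsSentence φ) (hψ : IsSentence ψ) :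
    FOTrue M I (.or φ ψ) ↔ FOTrue M I φ ∨ FOTrue M I ψ := by
  have foTrue_iff {χ : TS S ι ar} (hχ : IsSentence χ) (s : ℕ → M) :
      FOTrue M I χ ↔ FSat M I s χ :=
    ⟨fun h => h s, fun h t => (fSat_congr M I χ s t (by simp [show fv χ = ∅ from hχ])).mp h⟩
  have hor : IsSentence (.or φ ψ) := Set.union_empty_iff.mpr ⟨hφ, hψ⟩
  obtain ⟨s⟩ : Nonempty (ℕ → M) := inferInstance
  rw [foTrue_iff hφ s, foTrue_iff hψ s, foTrue_iff hor s]
  rfl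

/-- If each sentence of a list is first-order definable (with respect to some notion of truth
`T`), then so is their disjunction. -/
theorem exists_sentence_iff_exists_mem {S : Signature} {ι : Type} {ar : ι → ℕ}
    (T : ∀ M : Type, Interp S M → TS S ι ar → Prop) (L : List (TS S ι ar))
    (hL : ∀ χ ∈ L, ∃ ψ : FOF S, IsSentence ψ ∧ ∀ (M : Type), Nontrivial M →
      ∀ I : Interp S M, (T M I χ ↔ FOTrue M I ψ)) :
    ∃ ψ : FOF S, IsSentence ψ ∧ ∀ (M : Type), Nontrivial M →
      ∀ I : Interp S M, ((∃ χ ∈ L, T M I χ) ↔ FOTrue M I ψ) := by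
  induction L with
  | nil =>
    refine ⟨.al 0 (.neq 0 0), by simp [IsSentence, fv], fun M _ I => ?_⟩
    simp [FOTrue, FSat]
  | cons χ L ih =>
    obtain ⟨ψ₁, hs₁, h₁⟩ := hL χ (by simp)
    obtain ⟨ψ₂, hs₂, h₂⟩ := ih fun χ' h => hL χ' (by simp [h])
    refine ⟨.or ψ₁ ψ₂, Set.union_empty_iff.mpr ⟨hs₁, hs₂⟩, fun M hM I => ?_⟩
    rw [foTrue_or_iff M I hs₁ hs₂, ← h₁ M hM I, ← h₂ M hM I]
    simp

/-- Global disjunction is safe for any interpretation `A` of the atoms under which all plain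
sentences are first-order definable. -/
theorem exists_sentence_of_plain {S : Signature} {ι : Type} {ar : ι → ℕ}
    (A : ∀ M : Type, Interp S M → ∀ i, Set (Fin (ar i) → M) → Prop)
    (hA : ∀ χ : TS S ι ar, IsSentence χ → Plain χ → ∃ ψ : FOF S, IsSentence ψ ∧
      ∀ (M : Type), Nontrivial M → ∀ I : Interp S M, (TTrue M I (A M I) χ ↔ FOTrue M I ψ))
    (φ : TS S ι ar) (hs : IsSentence φ) (hφ : NoCneg φ) :
    ∃ ψ : FOF S, IsSentence ψ ∧
      ∀ (M : Type), Nontrivial M → ∀ I : Interp S M, (TTrue M I (A M I) φ ↔ FOTrue M I ψ) := by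
  obtain ⟨ψ, hψ, h⟩ := exists_sentence_iff_exists_mem (fun M I χ => TTrue M I (A M I) χ)
    (gdisjuncts φ) fun χ hχ => by
      obtain ⟨hp, hfv⟩ := plain_and_fv_subset_of_mem_gdisjuncts φ χ hχ
      exact hA χ (Set.subset_eq_empty hfv hs) hp
  exact ⟨ψ, hψ, fun M hM I =>
    (tSat_iff_exists_mem_gdisjuncts M I (A M I) φ hφ Set.univ).trans (h M hM I)⟩

/-- If `𝒟` is strongly first order, every sentence of `FO(⊔, 𝒟)`
is equivalent to some first-order sentence; if `𝒟` is moreover relativizable,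
every sentence of `FO(⊔, 𝒟^(P))` is equivalent to some first-order sentence. -/
theorem gdisj_safe_for_sfo {ι : Type} {ar : ι → ℕ} (D : ∀ i, DepPred (ar i))
    (hiso : ∀ i, IsoClosed (D i)) (hsfo : SFOFam D) :
    (∀ (S : Signature) (φ : TS S ι ar), IsSentence φ → NoCneg φ →
      ∃ ψ : FOF S, IsSentence ψ ∧
        ∀ (M : Type), Nontrivial M → ∀ I : Interp S M,
          (TTrue M I (fun i => D i M) φ ↔ FOTrue M I ψ)) ∧
    (RelativizableFam D →
      ∀ (S : Signature) (P : S 1) (φ : TS S ι ar), IsSentence φ → NoCneg φ →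
        ∃ ψ : FOF S, IsSentence ψ ∧
          ∀ (M : Type), Nontrivial M → ∀ I : Interp S M,
            (TTrue M I (fun i => relSem (D i) P M I) φ ↔ FOTrue M I ψ)) := by
  refine ⟨fun S φ => exists_sentence_of_plain (fun M _ i => D i M) (hsfo S) φ,
    fun hrel S P φ => exists_sentence_of_plain (fun M I i => relSem (D i) P M I) ?_ φ⟩
  intro χ hs hp
  obtain ⟨χ', hs', hp', h'⟩ := hrel S P χ hs hp
  obtain ⟨ψ, hψ, h⟩ := hsfo S χ' hs' hp'
  exact ⟨ψ, hψ, fun M hM I => (h' M hM I).trans (h M hM I)⟩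

end DSFO
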